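/- Let k ≥ 1 be an integer and take the weight φ(z) = |z|². For every ψ ∈ C_c^∞(ℂ), ⟨ψ, ∂^k ∂̄^k(∂̄_φ^{k*}∂_φ^{k*} ψ) − ∂̄_φ^{k*}∂_φ^{k*}(∂^k ∂̄^k ψ)⟩_φ = Σ_{(α,β) ∈ {0,…,k}², (α,β) ≠ (k,k)} [(k!)⁴ / ((α!)² (β!)² (k−α)! (k−β)!)] ‖∂^α ∂̄^β ψ‖_φ². In particular this quantity is a nonnegative real number. -/

import Mathlib

open MeasureTheory Complex Finset

/-- Wirtinger derivative ∂ = (1/2)(∂/∂x − i ∂/∂y). -/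
noncomputable def wD (f : ℂ → ℂ) : ℂ → ℂ :=
  fun z => (1 / 2 : ℂ) * (fderiv ℝ f z 1 - Complex.I * fderiv ℝ f z Complex.I)

/-- Conjugate Wirtinger derivative ∂̄ = (1/2)(∂/∂x + i ∂/∂y). -/
noncomputable def wDbar (f : ℂ → ℂ) : ℂ → ℂ :=
  fun z => (1 / 2 : ℂ) * (fderiv ℝ f z 1 + Complex.I * fderiv ℝ f z Complex.I)

/-- The operator ∂^k ∂̄^k. -/
noncomputable def Dk (k : ℕ) (f : ℂ → ℂ) : ℂ → ℂ := wD^[k] (wDbar^[k] f)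

/-- Membership in the weighted space L²(ℂ, e^{−φ}): f is (a.e. strongly) measurable,
locally square-integrable, and ∫ |f|² e^{−φ} < ∞. -/
def MemL2w (φ : ℂ → ℝ) (f : ℂ → ℂ) : Prop :=
  AEStronglyMeasurable f volume ∧
  LocallyIntegrable (fun z => ‖f z‖ ^ 2) volume ∧
  Integrable (fun z => ‖f z‖ ^ 2 * Real.exp (-(φ z))) volume

/-- Weighted inner product ⟨f, g⟩_φ = ∫ f̄ g e^{−φ} dσ. -/
noncomputable def innerW (φ : ℂ → ℝ) (f g : ℂ → ℂ) : ℂ :=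
  ∫ z, (starRingEnd ℂ) (f z) * g z * (Real.exp (-(φ z)) : ℂ)

/-- Weighted squared norm ‖f‖_φ² = ∫ |f|² e^{−φ} dσ. -/
noncomputable def normSqW (φ : ℂ → ℝ) (f : ℂ → ℂ) : ℝ :=
  ∫ z, ‖f z‖ ^ 2 * Real.exp (-(φ z))

/-- u is a weak solution of ∂^k ∂̄^k u + c u = f. -/
def IsWeakSol (k : ℕ) (c : ℂ) (u f : ℂ → ℂ) : Prop :=
  ∀ ψ : ℂ → ℂ, ContDiff ℝ (⊤ : ℕ∞) ψ → HasCompactSupport ψ →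
    (∫ z, u z * Dk k ψ z) + c * (∫ z, u z * ψ z) = ∫ z, f z * ψ z

/-- ∂̄_φ^{k*}∂_φ^{k*} ψ = e^{φ} ∂^k ∂̄^k (ψ e^{−φ}). -/
noncomputable def adjOp (k : ℕ) (φ : ℂ → ℝ) (ψ : ℂ → ℂ) : ℂ → ℂ :=
  fun z => (Real.exp (φ z) : ℂ) * Dk k (fun w => ψ w * (Real.exp (-(φ w)) : ℂ)) z

/-- The formal adjoint (∂^k ∂̄^k + c)_φ^* ψ = ∂̄_φ^{k*}∂_φ^{k*} ψ + c̄ ψ. -/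
noncomputable def adjOpC (k : ℕ) (c : ℂ) (φ : ℂ → ℝ) (ψ : ℂ → ℂ) : ℂ → ℂ :=
  fun z => adjOp k φ ψ z + (starRingEnd ℂ) c * ψ z

open scoped ContDiff

/-- Normal ordering in a Weyl algebra. -/
theorem pow_mul_pow_of_mul_eq_mul_add_one {R : Type*} [Ring R] {x y : R}
    (h : x * y = y * x + 1) (m n : ℕ) :
    x ^ m * y ^ n = ∑ j ∈ range (m + 1),
      ((m.choose j * n.descFactorial j : ℕ) : R) * (y ^ (n - j) * x ^ (m - j)) := by
  have hxy : ∀ n : ℕ, x * y ^ n = y ^ n * x + (n : R) * y ^ (n - 1) := by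
    intro n
    induction n with
    | zero => simp
    | succ n ih =>
      rw [pow_succ, ← mul_assoc, ih, add_mul, mul_assoc _ x y, h]
      rcases n with _ | n
      · simp
      · simp only [Nat.add_sub_cancel, pow_succ]
        push_cast
        noncomm_ring
  induction m with
  | zero => simp
  | succ m ih =>
    rw [pow_succ', mul_assoc, ih, mul_sum]
    have hterm : ∀ j ∈ range (m + 1),
        x * (((m.choose j * n.descFactorial j : ℕ) : R) * (y ^ (n - j) * x ^ (m - j))) =
          ((m.choose j * n.descFactorial j : ℕ) : R) * (y ^ (n - j) * x ^ (m + 1 - j)) +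
          ((m.choose j * n.descFactorial (j + 1) : ℕ) : R) *
            (y ^ (n - (j + 1)) * x ^ (m + 1 - (j + 1))) := by
      intro j hj
      have hj' : j ≤ m := Nat.lt_succ_iff.mp (mem_range.mp hj)
      rw [← mul_assoc, ← Nat.cast_comm, mul_assoc, ← mul_assoc x, hxy, add_mul, mul_add,
        mul_assoc (y ^ _) x, ← pow_succ', Nat.sub_add_comm hj', Nat.descFactorial_succ,
        Nat.add_sub_add_right, Nat.sub_sub]
      push_cast
      simp only [← mul_assoc]
      rw [mul_assoc (m.choose j : R) ((n - j : ℕ) : R),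
        (Nat.cast_commute (n - j) (n.descFactorial j : R)).eq, ← mul_assoc]
    rw [sum_congr rfl hterm, sum_add_distrib, sum_range_succ' _ (m + 1)]
    have hpascal : ∀ j ∈ range (m + 1),
        (((m + 1).choose (j + 1) * n.descFactorial (j + 1) : ℕ) : R) *
            (y ^ (n - (j + 1)) * x ^ (m + 1 - (j + 1))) =
          ((m.choose j * n.descFactorial (j + 1) : ℕ) : R) *
            (y ^ (n - (j + 1)) * x ^ (m + 1 - (j + 1))) +
          ((m.choose (j + 1) * n.descFactorial (j + 1) : ℕ) : R) *
            (y ^ (n - (j + 1)) * x ^ (m + 1 - (j + 1))) := by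
      intro j _
      rw [Nat.choose_succ_succ, ← add_mul, ← Nat.cast_add, ← add_mul]
    rw [sum_congr rfl hpascal, sum_add_distrib, sum_range_succ' _ m,
      sum_range_succ (fun j => ((m.choose (j + 1) * n.descFactorial (j + 1) : ℕ) : R) *
        (y ^ (n - (j + 1)) * x ^ (m + 1 - (j + 1)))) m]
    simp only [Nat.choose_succ_self, zero_mul, Nat.cast_zero, add_zero, Nat.choose_zero_right]
    abel

theorem choose_mul_descFactorial_sub {k a : ℕ} (h : a ≤ k) :
    (((k.choose (k - a) * k.descFactorial (k - a) : ℕ) : ℝ)) =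
      (k.factorial : ℝ) ^ 2 / ((a.factorial : ℝ) ^ 2 * ((k - a).factorial : ℝ)) := by
  have h1 : (a.factorial : ℝ) * k.descFactorial (k - a) = k.factorial := by
    have := Nat.factorial_mul_descFactorial (Nat.sub_le k a)
    rw [Nat.sub_sub_self h] at this
    exact_mod_cast this
  have h2 : (k.choose a : ℝ) * a.factorial * (k - a).factorial = k.factorial := by
    exact_mod_cast Nat.choose_mul_factorial_mul_factorial h
  have h3 : (k.descFactorial (k - a) : ℝ) = k.choose a * (k - a).factorial := by
    have : (a.factorial : ℝ) ≠ 0 := by positivity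
    apply mul_left_cancel₀ this
    rw [h1, ← h2]
    ring
  rw [Nat.choose_symm h, eq_div_iff (by positivity)]
  push_cast
  rw [h3, ← h2]
  ring

theorem wD_mul {f g : ℂ → ℂ} (hf : Differentiable ℝ f) (hg : Differentiable ℝ g) :
    wD (f * g) = wD f * g + f * wD g := by
  funext z
  simp only [wD, Pi.mul_apply, Pi.add_apply, fderiv_mul (hf z) (hg z)]
  simp
  ring

theorem wDbar_mul {f g : ℂ → ℂ} (hf : Differentiable ℝ f) (hg : Differentiable ℝ g) :
    wDbar (f * g) = wDbar f * g + f * wDbar g := by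
  funext z
  simp only [wDbar, Pi.mul_apply, Pi.add_apply, fderiv_mul (hf z) (hg z)]
  simp
  ring

theorem wD_id : wD (fun z => z) = 1 := by
  funext z
  simp [wD]
  norm_num

theorem wDbar_id : wDbar (fun z => z) = 0 := by
  funext z
  simp [wDbar]

theorem fderiv_conj_comp {f : ℂ → ℂ} (hf : Differentiable ℝ f) (z v : ℂ) :
    fderiv ℝ (fun z => (starRingEnd ℂ) (f z)) z v = (starRingEnd ℂ) (fderiv ℝ f z v) := by
  have := ((conjCLE : ℂ ≃L[ℝ] ℂ).toContinuousLinearMap.hasFDerivAt.comp z (hf z).hasFDerivAt).fderiv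
  exact DFunLike.congr_fun this v

theorem wD_conj {f : ℂ → ℂ} (hf : Differentiable ℝ f) :
    wD (fun z => (starRingEnd ℂ) (f z)) = fun z => (starRingEnd ℂ) (wDbar f z) := by
  funext z
  simp [wD, wDbar, fderiv_conj_comp hf, map_ofNat]
  ring

theorem wDbar_conj {f : ℂ → ℂ} (hf : Differentiable ℝ f) :
    wDbar (fun z => (starRingEnd ℂ) (f z)) = fun z => (starRingEnd ℂ) (wD f z) := by
  funext z
  simp [wD, wDbar, fderiv_conj_comp hf, map_ofNat]

/-- The Gaussian `e^{-|z|²}`, as a complex valued function. -/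
noncomputable def gaussianWeight : ℂ → ℂ := fun w => (Real.exp (-(‖w‖ ^ 2)) : ℂ)

theorem contDiff_gaussianWeight : ContDiff ℝ ∞ gaussianWeight :=
  ofRealCLM.contDiff.comp (Real.contDiff_exp.comp (contDiff_norm_sq ℝ).neg)

theorem fderiv_gaussianWeight (z v : ℂ) :
    fderiv ℝ gaussianWeight z v = -(2 * inner ℝ z v : ℝ) * gaussianWeight z := by
  have h := (ofRealCLM.hasFDerivAt.comp z
    ((hasStrictFDerivAt_norm_sq z).hasFDerivAt.neg.exp)).fderiv
  have h' := DFunLike.congr_fun h v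
  refine Eq.trans h' ?_
  simp [gaussianWeight]
  ring

theorem wD_gaussianWeight :
    wD gaussianWeight = fun z => -((starRingEnd ℂ) z * gaussianWeight z) := by
  funext z
  simp only [wD, fderiv_gaussianWeight]
  have hz : (z.re : ℂ) - z.im * I = (starRingEnd ℂ) z := Complex.ext (by simp) (by simp)
  simp [Complex.inner]
  linear_combination (-gaussianWeight z) * hz

theorem wDbar_gaussianWeight :
    wDbar gaussianWeight = fun z => -(z * gaussianWeight z) := by
  funext z
  simp only [wDbar, fderiv_gaussianWeight]
  simp [Complex.inner]
  linear_combination (-gaussianWeight z) * re_add_im z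

/-- The submodule of smooth compactly supported functions. -/
def smoothCompactSubmodule : Submodule ℂ (ℂ → ℂ) where
  carrier := {f | ContDiff ℝ ∞ f ∧ HasCompactSupport f}
  add_mem' hf hg := ⟨hf.1.add hg.1, hf.2.add hg.2⟩
  zero_mem' := ⟨contDiff_const, HasCompactSupport.zero⟩
  smul_mem' c _ hf := ⟨contDiff_const.smul hf.1, hf.2.smul_left (f := fun _ => c)⟩

/-- The space of smooth compactly supported functions. -/
def SmoothCompact : Type := smoothCompactSubmodule

namespace SmoothCompact

noncomputable instance : AddCommGroup SmoothCompact :=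
  inferInstanceAs (AddCommGroup smoothCompactSubmodule)

noncomputable instance : Module ℂ SmoothCompact :=
  inferInstanceAs (Module ℂ smoothCompactSubmodule)

instance : FunLike SmoothCompact ℂ ℂ where
  coe f := f.1
  coe_injective _ _ h := Subtype.ext h

/-- Bundle a smooth compactly supported function. -/
def mk (f : ℂ → ℂ) (hf : ContDiff ℝ ∞ f) (hc : HasCompactSupport f) : SmoothCompact :=
  Subtype.mk f ⟨hf, hc⟩

@[simp] theorem coe_mk (f : ℂ → ℂ) (hf : ContDiff ℝ ∞ f) (hc : HasCompactSupport f) :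
    (mk f hf hc : ℂ → ℂ) = f := rfl

@[ext] theorem ext {f g : SmoothCompact} (h : ∀ z, f z = g z) : f = g := DFunLike.ext _ _ h

@[simp] theorem coe_add (f g : SmoothCompact) : ⇑(f + g) = f + g := rfl

@[simp] theorem coe_sub (f g : SmoothCompact) : ⇑(f - g) = f - g := rfl

@[simp] theorem coe_smul (c : ℂ) (f : SmoothCompact) : ⇑(c • f) = c • ⇑f := rfl

@[simp] theorem coe_sum {ι : Type*} (s : Finset ι) (f : ι → SmoothCompact) :
    ⇑(∑ i ∈ s, f i) = ∑ i ∈ s, ⇑(f i) :=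
  map_sum smoothCompactSubmodule.subtype f s

theorem contDiff (f : SmoothCompact) : ContDiff ℝ ∞ f := f.2.1

theorem hasCompactSupport (f : SmoothCompact) : HasCompactSupport f := f.2.2

theorem differentiable (f : SmoothCompact) : Differentiable ℝ f :=
  f.contDiff.differentiable (by simp)

theorem integrable (f : SmoothCompact) : Integrable f :=
  f.contDiff.continuous.integrable_of_hasCompactSupport f.hasCompactSupport

theorem contDiff_conj (f : SmoothCompact) : ContDiff ℝ ∞ (fun z => (starRingEnd ℂ) (f z)) :=
  conjCLE.contDiff.comp f.contDiff

end SmoothCompact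

/-- Directional derivative on smooth compactly supported functions. -/
noncomputable def dirDeriv (v : ℂ) : Module.End ℂ SmoothCompact where
  toFun f := .mk (fun z => fderiv ℝ f z v)
    ((f.contDiff.fderiv_right (m := ∞) (by simp)).clm_apply contDiff_const)
    (f.hasCompactSupport.fderiv_apply ℝ v)
  map_add' f g := by
    ext z
    simp [fderiv_add (f.differentiable z) (g.differentiable z)]
  map_smul' c f := by
    ext z
    simp [fderiv_const_smul (f.differentiable z) c]

theorem dirDeriv_commute (v w : ℂ) : Commute (dirDeriv v) (dirDeriv w) := by
  ext f z
  have hd : DifferentiableAt ℝ (fderiv ℝ (f : ℂ → ℂ)) z :=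
    (f.contDiff.fderiv_right (m := ∞) (by simp)).differentiable (by simp) z
  have hs : IsSymmSndFDerivAt ℝ (f : ℂ → ℂ) z :=
    f.contDiff.contDiffAt.isSymmSndFDerivAt
      (by simpa using WithTop.coe_le_coe.mpr (le_top (a := (2 : ℕ∞))))
  have key : ∀ v w : ℂ, fderiv ℝ (fun y => fderiv ℝ (f : ℂ → ℂ) y w) z v =
      fderiv ℝ (fderiv ℝ (f : ℂ → ℂ)) z v w := by
    intro v w
    rw [fderiv_clm_apply hd (differentiableAt_const w)]
    simp
  exact (key v w).trans ((hs.eq v w).trans (key w v).symm)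

/-- `∂` as an operator on smooth compactly supported functions. -/
noncomputable def opD : Module.End ℂ SmoothCompact :=
  (1 / 2 : ℂ) • (dirDeriv 1 - I • dirDeriv I)

/-- `∂̄` as an operator on smooth compactly supported functions. -/
noncomputable def opDbar : Module.End ℂ SmoothCompact :=
  (1 / 2 : ℂ) • (dirDeriv 1 + I • dirDeriv I)

theorem coe_opD (f : SmoothCompact) : (opD f : ℂ → ℂ) = wD f := rfl

theorem coe_opDbar (f : SmoothCompact) : (opDbar f : ℂ → ℂ) = wDbar f := rfl

theorem coe_opD_pow (n : ℕ) (f : SmoothCompact) : ((opD ^ n) f : ℂ → ℂ) = wD^[n] f := by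
  induction n with
  | zero => rfl
  | succ n ih => rw [pow_succ', Function.iterate_succ_apply', Module.End.mul_apply, coe_opD, ih]

theorem coe_opDbar_pow (n : ℕ) (f : SmoothCompact) :
    ((opDbar ^ n) f : ℂ → ℂ) = wDbar^[n] f := by
  induction n with
  | zero => rfl
  | succ n ih =>
    rw [pow_succ', Function.iterate_succ_apply', Module.End.mul_apply, coe_opDbar, ih]

theorem opD_commute_opDbar : Commute opD opDbar := by
  have h := dirDeriv_commute 1 I
  refine (Commute.smul_right ?_ _).smul_left _
  exact ((Commute.refl _).add_right (h.smul_right _)).sub_left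
    ((h.symm.add_right ((Commute.refl _).smul_right _)).smul_left _)

/-- Multiplication by a smooth function. -/
noncomputable def mulOp (g : ℂ → ℂ) (hg : ContDiff ℝ ∞ g) : Module.End ℂ SmoothCompact where
  toFun f := .mk (g * f) (hg.mul f.contDiff) f.hasCompactSupport.mul_left
  map_add' f h := by ext z; simp [mul_add]
  map_smul' c f := by ext z; simp

theorem coe_mulOp (g : ℂ → ℂ) (hg : ContDiff ℝ ∞ g) (f : SmoothCompact) :
    (mulOp g hg f : ℂ → ℂ) = g * f := rfl

theorem mulOp_commute (g h : ℂ → ℂ) (hg : ContDiff ℝ ∞ g) (hh : ContDiff ℝ ∞ h) :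
    Commute (mulOp g hg) (mulOp h hh) := by
  ext f z
  simp [coe_mulOp]
  ring

theorem contDiff_conj : ContDiff ℝ ∞ (fun z : ℂ => (starRingEnd ℂ) z) := conjCLE.contDiff

/-- Multiplication by `z`. -/
noncomputable def opZ : Module.End ℂ SmoothCompact := mulOp (fun z => z) contDiff_id

/-- Multiplication by `z̄`. -/
noncomputable def opZbar : Module.End ℂ SmoothCompact := mulOp _ contDiff_conj

/-- Multiplication by `e^{-|z|²}`. -/
noncomputable def opW : Module.End ℂ SmoothCompact := mulOp _ contDiff_gaussianWeight

theorem opD_mul_opZ : opD * opZ = opZ * opD + 1 := by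
  ext f z
  have h := wD_mul differentiable_id f.differentiable
  exact (congrFun h z).trans (by
    have := congrFun wD_id z
    simp only [id_eq, Pi.add_apply, Pi.mul_apply]
    change wD (fun z => z) z * _ + _ = z * wD f z + (f : ℂ → ℂ) z
    rw [this]; simp; ring)

theorem wD_starRingEnd : wD (starRingEnd ℂ) = 0 := by
  rw [wD_conj (f := fun z => z) differentiable_id, wDbar_id]
  simp
  rfl

theorem wDbar_starRingEnd : wDbar (starRingEnd ℂ) = 1 := by
  rw [wDbar_conj (f := fun z => z) differentiable_id, wD_id]
  simp
  rfl

theorem opDbar_mul_opZ : opDbar * opZ = opZ * opDbar := by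
  ext f z
  exact (congrFun (wDbar_mul (f := fun z => z) differentiable_id f.differentiable) z).trans
    (by simp [wDbar_id, opZ, coe_mulOp, coe_opDbar])

theorem opD_mul_opZbar : opD * opZbar = opZbar * opD := by
  ext f z
  exact (congrFun (wD_mul Complex.differentiable_conj f.differentiable) z).trans
    (by simp [wD_starRingEnd, opZbar, coe_mulOp, coe_opD])

theorem opDbar_mul_opZbar : opDbar * opZbar = opZbar * opDbar + 1 := by
  ext f z
  exact (congrFun (wDbar_mul Complex.differentiable_conj f.differentiable) z).trans
    (by simp [wDbar_starRingEnd, opZbar, coe_mulOp, coe_opDbar, add_comm])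

theorem opD_mul_opW : opD * opW = opW * (opD - opZbar) := by
  ext f z
  exact (congrFun (wD_mul (contDiff_gaussianWeight.differentiable (by simp)) f.differentiable)
    z).trans (by simp [wD_gaussianWeight, opZbar, opW, coe_mulOp, coe_opD]; ring)

theorem opDbar_mul_opW : opDbar * opW = opW * (opDbar - opZ) := by
  ext f z
  exact (congrFun (wDbar_mul (contDiff_gaussianWeight.differentiable (by simp)) f.differentiable)
    z).trans (by simp [wDbar_gaussianWeight, opZ, opW, coe_mulOp, coe_opDbar]; ring)

/-- The weighted adjoint of `∂̄`. -/
noncomputable def opA : Module.End ℂ SmoothCompact := opZbar - opD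

/-- The weighted adjoint of `∂`. -/
noncomputable def opB : Module.End ℂ SmoothCompact := opZ - opDbar

theorem opD_mul_opB : opD * opB = opB * opD + 1 := by
  rw [opB, mul_sub, sub_mul, opD_mul_opZ, opD_commute_opDbar.eq]; abel

theorem opDbar_mul_opA : opDbar * opA = opA * opDbar + 1 := by
  rw [opA, mul_sub, sub_mul, opDbar_mul_opZbar, opD_commute_opDbar.eq]; abel

theorem opD_commute_opA : Commute opD opA :=
  Commute.sub_right opD_mul_opZbar (Commute.refl _)

theorem opDbar_commute_opB : Commute opDbar opB :=
  Commute.sub_right opDbar_mul_opZ (Commute.refl _)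

theorem opA_commute_opB : Commute opA opB := by
  have h : opZbar * opZ = opZ * opZbar := (mulOp_commute _ _ _ _).eq
  have h1 := opD_mul_opZ
  have h2 := opDbar_mul_opZbar
  rw [Commute, SemiconjBy, opA, opB, sub_mul, sub_mul, mul_sub, mul_sub, mul_sub, mul_sub, h1, h2,
    h, opD_commute_opDbar.eq]
  abel

theorem opD_pow_mul_opDbar_pow_mul_opW (k : ℕ) :
    opD ^ k * opDbar ^ k * opW = opW * (opA ^ k * opB ^ k) := by
  have hA : ∀ n : ℕ, opD ^ n * opW = opW * (-opA) ^ n := fun n =>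
    (SemiconjBy.pow_right (show SemiconjBy opW (-opA) opD by
      rw [SemiconjBy, opD_mul_opW, opA, neg_sub]) n).eq.symm
  have hB : ∀ n : ℕ, opDbar ^ n * opW = opW * (-opB) ^ n := fun n =>
    (SemiconjBy.pow_right (show SemiconjBy opW (-opB) opDbar by
      rw [SemiconjBy, opDbar_mul_opW, opB, neg_sub]) n).eq.symm
  rw [mul_assoc, hB, ← mul_assoc, hA, mul_assoc, ← (opA_commute_opB.neg_left.neg_right).mul_pow,
    neg_mul_neg, opA_commute_opB.mul_pow]

theorem coe_Dk (k : ℕ) (f : SmoothCompact) :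
    Dk k f = ((opD ^ k * opDbar ^ k) f : SmoothCompact) := by
  rw [Module.End.mul_apply, coe_opD_pow, coe_opDbar_pow, Dk]

theorem adjOp_norm_sq (k : ℕ) (f : SmoothCompact) :
    adjOp k (fun w => ‖w‖ ^ 2) f = ((opA ^ k * opB ^ k) f : SmoothCompact) := by
  have h : (fun w => (f : ℂ → ℂ) w * (Real.exp (-(‖w‖ ^ 2)) : ℂ)) = (opW f : SmoothCompact) := by
    funext w
    exact mul_comm _ _
  funext z
  rw [adjOp]
  simp only [h]
  rw [coe_Dk, ← Module.End.mul_apply, opD_pow_mul_opDbar_pow_mul_opW, Module.End.mul_apply, opW,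
    coe_mulOp, Pi.mul_apply, gaussianWeight, ← mul_assoc, ← ofReal_mul, ← Real.exp_add]
  simp

theorem integral_dirDeriv (v : ℂ) (f : SmoothCompact) : ∫ z, (dirDeriv v f : ℂ → ℂ) z = 0 := by
  have hint : Integrable (fun z => fderiv ℝ f z v) := (dirDeriv v f).integrable
  change ∫ z, fderiv ℝ f z v = 0
  have h := integral_smul_fderiv_eq_neg_fderiv_smul_of_integrable (𝕜 := ℝ) (μ := volume)
    (f := fun _ : ℂ => (1 : ℝ)) (g := f) (v := v) (by simp)
    (by simpa using hint) (by simpa using f.integrable)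
    (fun _ _ => differentiableAt_const _) (fun z _ => f.differentiable z)
  simpa using h

theorem integral_opD (f : SmoothCompact) : ∫ z, (opD f : ℂ → ℂ) z = 0 := by
  change ∫ z, (1 / 2 : ℂ) * ((dirDeriv 1 f : ℂ → ℂ) z - I * (dirDeriv I f : ℂ → ℂ) z) = 0
  rw [integral_const_mul, integral_sub (SmoothCompact.integrable _)
    ((SmoothCompact.integrable _).const_mul _), integral_const_mul, integral_dirDeriv,
    integral_dirDeriv]
  simp

theorem integral_opDbar (f : SmoothCompact) : ∫ z, (opDbar f : ℂ → ℂ) z = 0 := by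
  change ∫ z, (1 / 2 : ℂ) * ((dirDeriv 1 f : ℂ → ℂ) z + I * (dirDeriv I f : ℂ → ℂ) z) = 0
  rw [integral_const_mul, integral_add (SmoothCompact.integrable _)
    ((SmoothCompact.integrable _).const_mul _), integral_const_mul, integral_dirDeriv,
    integral_dirDeriv]
  simp

/-- The weighted pairing `f̄ g e^{-|z|²}`. -/
noncomputable def pairing (f g : SmoothCompact) : SmoothCompact :=
  mulOp _ f.contDiff_conj (opW g)

theorem innerW_eq_integral_pairing (f g : SmoothCompact) :
    innerW (fun w => ‖w‖ ^ 2) f g = ∫ z, (pairing f g : ℂ → ℂ) z := by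
  refine integral_congr_ae (.of_forall fun z => ?_)
  change (starRingEnd ℂ) (f z) * g z * (Real.exp (-(‖z‖ ^ 2)) : ℂ) =
    (starRingEnd ℂ) (f z) * (gaussianWeight z * g z)
  rw [gaussianWeight]
  ring

theorem opDbar_pairing (f g : SmoothCompact) :
    opDbar (pairing f g) = pairing (opD f) g - pairing f (opB g) := by
  ext z
  refine (congrFun (wDbar_mul (f.contDiff_conj.differentiable (by simp))
    (opW g).differentiable) z).trans ?_
  have h : wDbar (opW g : SmoothCompact) = (opW ((opDbar - opZ) g) : SmoothCompact) := by
    rw [← coe_opDbar, ← Module.End.mul_apply, opDbar_mul_opW, Module.End.mul_apply]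
  rw [h, wDbar_conj f.differentiable]
  simp [pairing, opB, coe_mulOp, coe_opD]
  ring

theorem opD_pairing (f g : SmoothCompact) :
    opD (pairing f g) = pairing (opDbar f) g - pairing f (opA g) := by
  ext z
  refine (congrFun (wD_mul (f.contDiff_conj.differentiable (by simp))
    (opW g).differentiable) z).trans ?_
  have h : wD (opW g : SmoothCompact) = (opW ((opD - opZbar) g) : SmoothCompact) := by
    rw [← coe_opD, ← Module.End.mul_apply, opD_mul_opW, Module.End.mul_apply]
  rw [h, wD_conj f.differentiable]
  simp [pairing, opA, coe_mulOp, coe_opDbar]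
  ring

theorem innerW_opB (f g : SmoothCompact) :
    innerW (fun w => ‖w‖ ^ 2) f (opB g : SmoothCompact) =
      innerW (fun w => ‖w‖ ^ 2) (opD f : SmoothCompact) g := by
  have h := integral_opDbar (pairing f g)
  rw [opDbar_pairing] at h
  rw [innerW_eq_integral_pairing, innerW_eq_integral_pairing]
  refine (sub_eq_zero.mp ?_).symm
  rw [← integral_sub (SmoothCompact.integrable _) (SmoothCompact.integrable _)]
  exact h

theorem innerW_opA (f g : SmoothCompact) :
    innerW (fun w => ‖w‖ ^ 2) f (opA g : SmoothCompact) =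
      innerW (fun w => ‖w‖ ^ 2) (opDbar f : SmoothCompact) g := by
  have h := integral_opD (pairing f g)
  rw [opD_pairing] at h
  rw [innerW_eq_integral_pairing, innerW_eq_integral_pairing]
  refine (sub_eq_zero.mp ?_).symm
  rw [← integral_sub (SmoothCompact.integrable _) (SmoothCompact.integrable _)]
  exact h

theorem innerW_opB_pow (n : ℕ) (f g : SmoothCompact) :
    innerW (fun w => ‖w‖ ^ 2) f ((opB ^ n) g : SmoothCompact) =
      innerW (fun w => ‖w‖ ^ 2) ((opD ^ n) f : SmoothCompact) g := by
  induction n generalizing f with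
  | zero => rfl
  | succ n ih =>
    rw [pow_succ', Module.End.mul_apply, innerW_opB, ih, pow_succ, Module.End.mul_apply]

theorem innerW_opA_pow (n : ℕ) (f g : SmoothCompact) :
    innerW (fun w => ‖w‖ ^ 2) f ((opA ^ n) g : SmoothCompact) =
      innerW (fun w => ‖w‖ ^ 2) ((opDbar ^ n) f : SmoothCompact) g := by
  induction n generalizing f with
  | zero => rfl
  | succ n ih =>
    rw [pow_succ', Module.End.mul_apply, innerW_opA, ih, pow_succ, Module.End.mul_apply]

theorem innerW_self (φ : ℂ → ℝ) (f : ℂ → ℂ) : innerW φ f f = (normSqW φ f : ℂ) := by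
  rw [innerW, normSqW, ← integral_complex_ofReal]
  refine integral_congr_ae (.of_forall fun z => ?_)
  simp only [conj_mul']
  push_cast
  rfl

theorem normSqW_nonneg (φ : ℂ → ℝ) (f : ℂ → ℂ) : 0 ≤ normSqW φ f :=
  integral_nonneg fun z => by positivity

theorem innerW_opB_pow_opA_pow (a b : ℕ) (f : SmoothCompact) :
    innerW (fun w => ‖w‖ ^ 2) f
        ((opB ^ a * opA ^ b * (opD ^ a * opDbar ^ b)) f : SmoothCompact) =
      (normSqW (fun w => ‖w‖ ^ 2) (wD^[a] (wDbar^[b] f)) : ℂ) := by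
  rw [Module.End.mul_apply, Module.End.mul_apply, innerW_opB_pow, innerW_opA_pow,
    ← Module.End.mul_apply, ← (opD_commute_opDbar.pow_pow a b).eq, innerW_self,
    Module.End.mul_apply, coe_opD_pow, coe_opDbar_pow]

theorem innerW_sum_smul {ι : Type*} (s : Finset ι) (c : ι → ℂ) (f : SmoothCompact)
    (g : ι → SmoothCompact) :
    innerW (fun w => ‖w‖ ^ 2) f (∑ i ∈ s, c i • g i : SmoothCompact) =
      ∑ i ∈ s, c i * innerW (fun w => ‖w‖ ^ 2) f (g i) := by
  simp only [innerW_eq_integral_pairing, ← integral_const_mul]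
  rw [← integral_finsetSum _ fun i _ => (SmoothCompact.integrable _).const_mul _]
  refine integral_congr_ae (.of_forall fun z => ?_)
  simp [pairing, coe_mulOp, opW]

/-- The normal ordering coefficient `k!² / (a!² (k - a)!)`. -/
noncomputable def normalOrderCoeff (k a : ℕ) : ℝ :=
  (k.factorial : ℝ) ^ 2 / ((a.factorial : ℝ) ^ 2 * ((k - a).factorial : ℝ))

theorem normalOrderCoeff_self (k : ℕ) : normalOrderCoeff k k = 1 := by
  have : (k.factorial : ℝ) ≠ 0 := by positivity
  simp [normalOrderCoeff, this]

theorem pow_mul_pow_eq_sum_normalOrderCoeff {R : Type*} [Ring R] [Algebra ℂ R] {x y : R}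
    (h : x * y = y * x + 1) (k : ℕ) :
    x ^ k * y ^ k = ∑ a ∈ range (k + 1), (normalOrderCoeff k a : ℂ) • (y ^ a * x ^ a) := by
  rw [pow_mul_pow_of_mul_eq_mul_add_one h, ← sum_range_reflect]
  refine sum_congr rfl fun a ha => ?_
  have ha' : a ≤ k := Nat.lt_succ_iff.mp (mem_range.mp ha)
  rw [normalOrderCoeff, ← choose_mul_descFactorial_sub ha', Nat.add_sub_cancel,
    Nat.sub_sub_self ha', ofReal_natCast, Nat.cast_smul_eq_nsmul, nsmul_eq_mul]

theorem opD_opDbar_opA_opB_eq_sum (k : ℕ) :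
    opD ^ k * opDbar ^ k * (opA ^ k * opB ^ k) - opA ^ k * opB ^ k * (opD ^ k * opDbar ^ k) =
      ∑ p ∈ (range (k + 1) ×ˢ range (k + 1)).filter (fun p => p ≠ (k, k)),
        ((normalOrderCoeff k p.1 * normalOrderCoeff k p.2 : ℝ) : ℂ) •
          (opB ^ p.1 * opA ^ p.2 * (opD ^ p.1 * opDbar ^ p.2)) := by
  have hterm : ∀ a b : ℕ, opB ^ a * opD ^ a * (opA ^ b * opDbar ^ b) =
      opB ^ a * opA ^ b * (opD ^ a * opDbar ^ b) := fun a b => by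
    rw [mul_assoc, ← mul_assoc (opD ^ a), (opD_commute_opA.pow_pow a b).eq]
    simp only [mul_assoc]
  have hfull : opD ^ k * opDbar ^ k * (opA ^ k * opB ^ k) =
      ∑ p ∈ range (k + 1) ×ˢ range (k + 1),
        ((normalOrderCoeff k p.1 * normalOrderCoeff k p.2 : ℝ) : ℂ) •
          (opB ^ p.1 * opA ^ p.2 * (opD ^ p.1 * opDbar ^ p.2)) := by
    rw [(opA_commute_opB.pow_pow k k).eq, mul_assoc, ← mul_assoc (opDbar ^ k),
      (opDbar_commute_opB.pow_pow k k).eq, mul_assoc, ← mul_assoc,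
      pow_mul_pow_eq_sum_normalOrderCoeff opD_mul_opB,
      pow_mul_pow_eq_sum_normalOrderCoeff opDbar_mul_opA, sum_mul_sum, sum_product]
    refine sum_congr rfl fun a _ => sum_congr rfl fun b _ => ?_
    rw [smul_mul_smul_comm, hterm, ofReal_mul]
  have hmem : (k, k) ∈ range (k + 1) ×ˢ range (k + 1) := by simp
  rw [hfull, filter_ne', ← add_sum_erase _ _ hmem, normalOrderCoeff_self,
    (opA_commute_opB.pow_pow k k).eq]
  simp

/-- with φ(z) = |z|²,
⟨ψ, ∂^k ∂̄^k(∂̄_φ^{k*}∂_φ^{k*} ψ) − ∂̄_φ^{k*}∂_φ^{k*}(∂^k ∂̄^k ψ)⟩_φ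
  = Σ_{(α,β)≠(k,k)} [(k!)⁴/((α!)²(β!)²(k−α)!(k−β)!)] ‖∂^α ∂̄^β ψ‖_φ²,
a nonnegative real number. -/
theorem stmt6 (k : ℕ) (hk : 1 ≤ k)
    (ψ : ℂ → ℂ) (hψ : ContDiff ℝ (⊤ : ℕ∞) ψ) (hψc : HasCompactSupport ψ) :
    innerW (fun w => ‖w‖ ^ 2) ψ
        (fun z => Dk k (adjOp k (fun w => ‖w‖ ^ 2) ψ) z -
          adjOp k (fun w => ‖w‖ ^ 2) (Dk k ψ) z) =
      ((∑ p ∈ (Finset.range (k + 1) ×ˢ Finset.range (k + 1)).filter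
            (fun p => p ≠ (k, k)),
          ((k.factorial : ℝ) ^ 4 /
              ((p.1.factorial : ℝ) ^ 2 * (p.2.factorial : ℝ) ^ 2 *
                ((k - p.1).factorial : ℝ) * ((k - p.2).factorial : ℝ))) *
            normSqW (fun w => ‖w‖ ^ 2) (wD^[p.1] (wDbar^[p.2] ψ)) : ℝ) : ℂ) ∧
      0 ≤ ∑ p ∈ (Finset.range (k + 1) ×ˢ Finset.range (k + 1)).filter
            (fun p => p ≠ (k, k)),
          ((k.factorial : ℝ) ^ 4 /
              ((p.1.factorial : ℝ) ^ 2 * (p.2.factorial : ℝ) ^ 2 *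
                ((k - p.1).factorial : ℝ) * ((k - p.2).factorial : ℝ))) *
            normSqW (fun w => ‖w‖ ^ 2) (wD^[p.1] (wDbar^[p.2] ψ)) := by
  have hcoeff : ∀ p : ℕ × ℕ, (k.factorial : ℝ) ^ 4 / ((p.1.factorial : ℝ) ^ 2 *
      (p.2.factorial : ℝ) ^ 2 * ((k - p.1).factorial : ℝ) * ((k - p.2).factorial : ℝ)) =
      normalOrderCoeff k p.1 * normalOrderCoeff k p.2 := fun p => by
    rw [normalOrderCoeff, normalOrderCoeff, div_mul_div_comm]
    congr 1 <;> ring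
  refine ⟨?_, sum_nonneg fun p _ => mul_nonneg (by positivity) (normSqW_nonneg _ _)⟩
  simp only [hcoeff]
  obtain ⟨f, rfl⟩ : ∃ f : SmoothCompact, ⇑f = ψ := ⟨.mk ψ hψ hψc, rfl⟩
  have hop : (fun z => Dk k (adjOp k (fun w => ‖w‖ ^ 2) f) z -
      adjOp k (fun w => ‖w‖ ^ 2) (Dk k f) z) =
      ((opD ^ k * opDbar ^ k * (opA ^ k * opB ^ k) -
        opA ^ k * opB ^ k * (opD ^ k * opDbar ^ k)) f : SmoothCompact) := by
    rw [coe_Dk, adjOp_norm_sq, adjOp_norm_sq, coe_Dk]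
    rfl
  rw [hop, opD_opDbar_opA_opB_eq_sum, LinearMap.sum_apply]
  simp only [LinearMap.smul_apply]
  rw [innerW_sum_smul, ofReal_sum]
  refine sum_congr rfl fun p _ => ?_
  rw [innerW_opB_pow_opA_pow, ofReal_mul _ (normSqW _ _)]
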